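/- Let V be a real inner product space which is the internal direct sum of pairwise orthogonal subspaces D₁, …, D_k. For each i let φᵢ, hᵢ : V → V be linear maps which map Dᵢ into Dᵢ and vanish on Dⱼ for every j ≠ i, and suppose: φᵢ is skew-adjoint (⟨φᵢx, y⟩ = −⟨x, φᵢy⟩), hᵢ is self-adjoint (⟨hᵢx, y⟩ = ⟨x, hᵢy⟩), and hᵢφᵢ + φᵢhᵢ = 0. Let ξᵢ ∈ Dᵢ be unit vectors with φᵢξᵢ = 0 and hᵢξᵢ = 0, and let κᵢ, μᵢ, μᵢ′ be real numbers. Define f = Σᵢ φᵢ, P = −(1/k) Σᵢ κᵢ φᵢ², H₁ = (1/k) Σᵢ μᵢ hᵢ, H₂ = (1/k) Σᵢ μᵢ′ hᵢφᵢ, and ξ = (1/√k)(ξ₁ + ⋯ + ξ_k). Then: P, H₁, H₂ are self-adjoint; P f = f P; H₁ f + f H₁ = 0 and H₂ f + f H₂ = 0; P H₁ = H₁ P and P H₂ = H₂ P; and P ξ = H₁ ξ = H₂ ξ = 0. -/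

import Mathlib

open RealInnerProductSpace

/-- On an orthogonal internal direct sum `V = D₁ ⊕ ⋯ ⊕ D_k`, with
skew-adjoint maps `φᵢ` and self-adjoint maps `hᵢ` acting inside `Dᵢ` and vanishing on
the other summands, anticommuting (`hᵢφᵢ + φᵢhᵢ = 0`), and unit vectors `ξᵢ ∈ Dᵢ`
killed by `φᵢ` and `hᵢ`, the operators `f = Σφᵢ`, `P = −(1/k)Σκᵢφᵢ²`,
`H₁ = (1/k)Σμᵢhᵢ`, `H₂ = (1/k)Σμᵢ′hᵢφᵢ` and `ξ = (ξ₁+⋯+ξ_k)/√k` satisfy: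
`P, H₁, H₂` self-adjoint, `Pf = fP`, `H₁f + fH₁ = 0`, `H₂f + fH₂ = 0`,
`PH₁ = H₁P`, `PH₂ = H₂P`, and `Pξ = H₁ξ = H₂ξ = 0`. -/
theorem sewing_stmt_13 {V : Type*} [NormedAddCommGroup V] [InnerProductSpace ℝ V]
    {k : ℕ} (hk : 0 < k) (D : Fin k → Submodule ℝ V)
    (hinternal : DirectSum.IsInternal D)
    (horth : ∀ i j, i ≠ j → ∀ x ∈ D i, ∀ y ∈ D j, ⟪x, y⟫ = 0)
    (φ h : Fin k → (V →ₗ[ℝ] V))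
    (hφmap : ∀ i, ∀ x ∈ D i, φ i x ∈ D i)
    (hφvanish : ∀ i j, i ≠ j → ∀ x ∈ D j, φ i x = 0)
    (hhmap : ∀ i, ∀ x ∈ D i, h i x ∈ D i)
    (hhvanish : ∀ i j, i ≠ j → ∀ x ∈ D j, h i x = 0)
    (hφskew : ∀ i, ∀ x y : V, ⟪φ i x, y⟫ = -⟪x, φ i y⟫)
    (hhsym : ∀ i, ∀ x y : V, ⟪h i x, y⟫ = ⟪x, h i y⟫)
    (hanti : ∀ i, ∀ x : V, h i (φ i x) + φ i (h i x) = 0)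
    (ξ : Fin k → V)
    (hξD : ∀ i, ξ i ∈ D i)
    (hξnorm : ∀ i, ‖ξ i‖ = 1)
    (hφξ : ∀ i, φ i (ξ i) = 0)
    (hhξ : ∀ i, h i (ξ i) = 0)
    (κ μ μ' : Fin k → ℝ)
    (f P H₁ H₂ : V →ₗ[ℝ] V) (ξbar : V)
    (hf : f = ∑ i, φ i)
    (hP : P = -((k : ℝ)⁻¹ • ∑ i, κ i • (φ i ∘ₗ φ i)))
    (hH₁ : H₁ = (k : ℝ)⁻¹ • ∑ i, μ i • h i)
    (hH₂ : H₂ = (k : ℝ)⁻¹ • ∑ i, μ' i • (h i ∘ₗ φ i))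
    (hξbar : ξbar = (Real.sqrt k)⁻¹ • ∑ i, ξ i) :
    (∀ x y : V, ⟪P x, y⟫ = ⟪x, P y⟫) ∧
    (∀ x y : V, ⟪H₁ x, y⟫ = ⟪x, H₁ y⟫) ∧
    (∀ x y : V, ⟪H₂ x, y⟫ = ⟪x, H₂ y⟫) ∧
    P ∘ₗ f = f ∘ₗ P ∧
    H₁ ∘ₗ f + f ∘ₗ H₁ = 0 ∧
    H₂ ∘ₗ f + f ∘ₗ H₂ = 0 ∧
    P ∘ₗ H₁ = H₁ ∘ₗ P ∧
    P ∘ₗ H₂ = H₂ ∘ₗ P ∧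
    P ξbar = 0 ∧ H₁ ξbar = 0 ∧ H₂ ξbar = 0 := by
  have hext : ∀ A B : V →ₗ[ℝ] V, (∀ j, ∀ x ∈ D j, A x = B x) → A = B := by
    intro A B hAB
    have hle : iSup D ≤ LinearMap.eqLocus A B := iSup_le fun j x hx => hAB j x hx
    rw [hinternal.submodule_iSup_eq_top] at hle
    exact LinearMap.ext fun x => hle Submodule.mem_top
  have hfD : ∀ j, ∀ x ∈ D j, f x = φ j x := by
    intro j x hx
    rw [hf, LinearMap.sum_apply]
    exact Finset.sum_eq_single j (fun i _ hij => hφvanish i j hij x hx) (by simp)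
  have hPD : ∀ j, ∀ x ∈ D j, P x = -((k : ℝ)⁻¹ • κ j • φ j (φ j x)) := by
    intro j x hx
    rw [hP, LinearMap.neg_apply, LinearMap.smul_apply, LinearMap.sum_apply,
      Finset.sum_eq_single j (fun i _ hij => by simp [hφvanish i j hij x hx]) (by simp)]
    simp
  have hH₁D : ∀ j, ∀ x ∈ D j, H₁ x = (k : ℝ)⁻¹ • μ j • h j x := by
    intro j x hx
    rw [hH₁, LinearMap.smul_apply, LinearMap.sum_apply,
      Finset.sum_eq_single j (fun i _ hij => by simp [hhvanish i j hij x hx]) (by simp)]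
    simp
  have hH₂D : ∀ j, ∀ x ∈ D j, H₂ x = (k : ℝ)⁻¹ • μ' j • h j (φ j x) := by
    intro j x hx
    rw [hH₂, LinearMap.smul_apply, LinearMap.sum_apply,
      Finset.sum_eq_single j (fun i _ hij => by simp [hφvanish i j hij x hx]) (by simp)]
    simp
  have hc : ∀ i, ∀ x : V, h i (φ i x) = -φ i (h i x) :=
    fun i x => eq_neg_of_add_eq_zero_left (hanti i x)
  have hz : ∀ A : V →ₗ[ℝ] V, (∀ j, A (ξ j) = 0) → A ξbar = 0 := by
    intro A hA
    rw [hξbar, map_smul, map_sum, Finset.sum_eq_zero (fun j _ => hA j), smul_zero]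
  refine ⟨?_, ?_, ?_, ?_, ?_, ?_, ?_, ?_, ?_, ?_, ?_⟩
  · intro x y
    simp [hP, inner_neg_left, inner_neg_right, inner_smul_left, inner_smul_right, sum_inner,
      inner_sum, hφskew]
  · intro x y
    simp [hH₁, inner_smul_left, inner_smul_right, sum_inner, inner_sum, hhsym]
  · intro x y
    simp [hH₂, inner_smul_left, inner_smul_right, sum_inner, inner_sum, hhsym, hφskew, hc]
  · refine hext _ _ fun j x hx => ?_
    have h1 := hφmap j x hx
    have h2 := hφmap j _ h1
    simp [hPD j x hx, hfD j x hx, hPD j _ h1, hfD j _ h2]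
  · refine hext _ _ fun j x hx => ?_
    have h1 := hφmap j x hx
    have h2 := hhmap j x hx
    simp [hH₁D j x hx, hfD j x hx, hH₁D j _ h1, hfD j _ h2, hc]
  · refine hext _ _ fun j x hx => ?_
    have h1 := hφmap j x hx
    have h2 := hhmap j _ h1
    rw [LinearMap.add_apply, LinearMap.comp_apply, LinearMap.comp_apply, hH₂D j x hx,
      hfD j x hx, hH₂D j _ h1, map_smul, map_smul, hfD j _ h2, hc j (φ j x)]
    simp
  · refine hext _ _ fun j x hx => ?_
    have h1 := hφmap j _ (hφmap j x hx)
    have h2 := hhmap j x hx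
    simp [hH₁D j x hx, hPD j x hx, hPD j _ h2, hH₁D j _ h1, hc]
    module
  · refine hext _ _ fun j x hx => ?_
    have h1 := hφmap j _ (hφmap j x hx)
    have h2 := hhmap j _ (hφmap j x hx)
    simp only [LinearMap.comp_apply, hH₂D j x hx, hPD j x hx, map_smul, map_neg, hPD j _ h2,
      hH₂D j _ h1]
    simp only [hc, map_neg, smul_neg, neg_neg]
    module
  · exact hz _ fun j => by rw [hPD j _ (hξD j)]; simp [hφξ]
  · exact hz _ fun j => by rw [hH₁D j _ (hξD j)]; simp [hhξ]
  · exact hz _ fun j => by rw [hH₂D j _ (hξD j)]; simp [hφξ]
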